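/- Assume condition (f.1) and m₂⁺ = p⁻, where m₂⁺ = max_{x∈S} m₂(x) and p⁻ = min_{x∈S} p(x). Set λ₁ = [(q⁻/p⁺) · 2^{−p⁻/2} · |∂S|^{p⁻/2} · |S̄|^{1−p⁻}] / [((φ₂⁺/m₂⁻) + ψ₂⁺ · |S̄|^{1/2}) · |S|]. Then for every λ ∈ (0, λ₁) the problem −Δ_{p(x),ω}u(x) + q(x)|u(x)|^{p(x)−2}u(x) = λ f(x, u(x)) on S, u = 0 on ∂S, has at least one positive solution. -/

import Mathlib

open Finset

/-- For `r ≥ 0`, the map `a ↦ |a| ^ r * a` is monotone. -/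
lemma monotone_abs_rpow_mul_self {r : ℝ} (hr : 0 ≤ r) : Monotone fun a : ℝ => |a| ^ r * a := by
  have key : ∀ a b : ℝ, 0 ≤ a → a ≤ b → |a| ^ r * a ≤ |b| ^ r * b := by
    intro a b ha hab
    have hb := ha.trans hab
    rw [abs_of_nonneg ha, abs_of_nonneg hb]
    gcongr
  intro a b hab
  rcases le_total 0 a with ha | ha
  · exact key a b ha hab
  rcases le_total 0 b with hb | hb
  · have h1 : |a| ^ r * a ≤ 0 := mul_nonpos_of_nonneg_of_nonpos (by positivity) ha
    have h2 : 0 ≤ |b| ^ r * b := by positivity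
    exact h1.trans h2
  · have := key (-b) (-a) (by linarith) (by linarith)
    simp only [abs_neg] at this
    show |a| ^ r * a ≤ |b| ^ r * b
    linarith

/-- For `r ≥ 0`, the map `a ↦ |a| ^ r * a` is continuous. -/
lemma continuous_abs_rpow_mul_self {r : ℝ} (hr : 0 ≤ r) :
    Continuous fun a : ℝ => |a| ^ r * a :=
  (continuous_abs.rpow_const fun _ => Or.inr hr).mul continuous_id

/-- The sub- and supersolution principle for a finite system `G x u = 0` in which `G x` is
continuous and nonincreasing in the coordinates other than `x`. -/
lemma exists_eq_zero_between_sub_and_supersolution {V : Type*} [Fintype V] [DecidableEq V]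
    (S : Finset V) (G : V → (V → ℝ) → ℝ) (hc : ∀ x ∈ S, Continuous (G x))
    (hG : ∀ x ∈ S, ∀ u v : V → ℝ, u ≤ v → u x = v x → G x v ≤ G x u)
    {v w : V → ℝ} (hvw : v ≤ w) (hv : ∀ x ∈ S, G x v ≤ 0) (hw : ∀ x ∈ S, 0 ≤ G x w) :
    ∃ u ∈ Set.Icc v w, ∀ x ∈ S, G x u = 0 := by
  let K : Set (V → ℝ) := Set.Icc v w ∩ {u | ∀ x ∈ S, G x u ≤ 0}
  have hKc : IsCompact K := by
    refine isCompact_Icc.inter_right ?_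
    simp only [Set.ofPred_forall]
    exact isClosed_iInter fun x => isClosed_iInter fun hx =>
      isClosed_le (hc x hx) continuous_const
  obtain ⟨u, ⟨⟨hvu, huw⟩, hu⟩, hmax⟩ := hKc.exists_isMaxOn (f := fun u : V → ℝ => ∑ y, u y)
    ⟨v, ⟨le_rfl, hvw⟩, hv⟩ (by fun_prop)
  refine ⟨u, ⟨hvu, huw⟩, fun x hx => le_antisymm (hu x hx) ?_⟩
  by_contra! hneg
  have hlt : u x < w x := by
    refine lt_of_le_of_ne (huw x) fun h => ?_
    have := hG x hx u w huw h
    linarith [hw x hx]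
  have hcont : Continuous fun t : ℝ => G x (Function.update u x t) :=
    (hc x hx).comp (continuous_const.update x continuous_id)
  have hev : ∀ᶠ t in nhds (u x), G x (Function.update u x t) < 0 :=
    hcont.continuousAt.eventually_lt continuousAt_const (by simpa using hneg)
  obtain ⟨t, ⟨htG, htw⟩, hut⟩ :=
    (((hev.and (eventually_lt_nhds hlt)).filter_mono nhdsWithin_le_nhds).and
      (self_mem_nhdsWithin : Set.Ioi (u x) ∈ nhdsWithin (u x) (Set.Ioi (u x)))).exists
  have hle : u ≤ Function.update u x t := le_update_self_iff.2 (le_of_lt hut)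
  have hmem : Function.update u x t ∈ K := by
    refine ⟨⟨hvu.trans hle, update_le_iff.2 ⟨htw.le, fun y _ => huw y⟩⟩, fun y hy => ?_⟩
    rcases eq_or_ne y x with rfl | hyx
    · exact htG.le
    · exact (hG y hy _ _ hle (by simp [hyx])).trans (hu y hy)
  have hsum : ∑ y, u y < ∑ y, Function.update u x t y :=
    Finset.sum_lt_sum (fun y _ => hle y) ⟨x, mem_univ x, by simpa using hut⟩
  exact absurd (hmax hmem) (not_le.2 hsum)

/-- The threshold `λ₁` is at most `Q / (Φ + Ψ)`, for parameters in the relevant range. -/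
lemma threshold_mul_le {Q P P' M Φ Ψ b n s : ℝ} (hQ : 0 < Q) (hP' : 2 ≤ P') (hPP : P' ≤ P)
    (hM : 0 < M) (hMP : M ≤ P') (hΦ : 0 < Φ) (hΨ : 0 < Ψ) (hb : 0 ≤ b) (hbn : b ≤ n)
    (hn : 1 ≤ n) (hs : 1 ≤ s) :
    Q / P * (2 : ℝ) ^ (-(P' / 2)) * b ^ (P' / 2) * n ^ (1 - P') /
      ((Φ / M + Ψ * Real.sqrt n) * s) * (Φ + Ψ) ≤ Q := by
  have hP : 0 < P := by linarith
  have h1 : (2 : ℝ) ^ (-(P' / 2)) ≤ 1 :=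
    Real.rpow_le_one_of_one_le_of_nonpos one_le_two (by linarith)
  have h2 : b ^ (P' / 2) * n ^ (1 - P') ≤ 1 := calc
    b ^ (P' / 2) * n ^ (1 - P') ≤ n ^ (P' / 2) * n ^ (1 - P') := by gcongr
    _ = n ^ (P' / 2 + (1 - P')) := (Real.rpow_add (by linarith) _ _).symm
    _ ≤ 1 := Real.rpow_le_one_of_one_le_of_nonpos hn (by linarith)
  have hnum : Q / P * (2 : ℝ) ^ (-(P' / 2)) * b ^ (P' / 2) * n ^ (1 - P') ≤ Q / P := calc
    _ = Q / P * ((2 : ℝ) ^ (-(P' / 2)) * (b ^ (P' / 2) * n ^ (1 - P'))) := by ring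
    _ ≤ Q / P * 1 := by
      gcongr
      exact mul_le_one₀ h1 (by positivity) h2
    _ = Q / P := mul_one _
  have hsq : 1 ≤ Real.sqrt n := Real.one_le_sqrt.2 hn
  have hden : (Φ + Ψ) / P ≤ (Φ / M + Ψ * Real.sqrt n) * s := calc
    (Φ + Ψ) / P = Φ / P + Ψ / P := add_div _ _ _
    _ ≤ Φ / M + Ψ * Real.sqrt n := by
      have h3 : Φ / P ≤ Φ / M := by gcongr; linarith
      have h4 : Ψ / P ≤ Ψ := div_le_self hΨ.le (by linarith)
      have h5 : Ψ ≤ Ψ * Real.sqrt n := le_mul_of_one_le_right hΨ.le hsq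
      linarith
    _ ≤ _ := le_mul_of_one_le_right (by positivity) hs
  have hD : 0 < (Φ / M + Ψ * Real.sqrt n) * s := by positivity
  rw [div_mul_eq_mul_div, div_le_iff₀ hD]
  calc _ ≤ Q / P * (Φ + Ψ) := by gcongr
    _ = Q * ((Φ + Ψ) / P) := by ring
    _ ≤ _ := by gcongr

/-- Under condition (f.1) and `m₂⁺ = p⁻`, for every `λ ∈ (0, λ₁)` with
`λ₁ = [(q⁻/p⁺)·2^{−p⁻/2}·|∂S|^{p⁻/2}·|S̄|^{1−p⁻}] / [((φ₂⁺/m₂⁻) + ψ₂⁺·|S̄|^{1/2})·|S|]`,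
the problem has at least one positive solution. -/
theorem stmt_15 {V : Type*} [Fintype V] [DecidableEq V]
    (S B : Finset V) (hS : S.Nonempty) (hB : B.Nonempty)
    (hdisj : Disjoint S B) (hcover : S ∪ B = Finset.univ)
    (ω : V → V → ℝ) (hsym : ∀ x y, ω x y = ω y x) (hnn : ∀ x y, 0 ≤ ω x y)
    (p : V → ℝ) (hp : ∀ x, 2 ≤ p x)
    (q : V → ℝ) (hq : ∀ x ∈ S, 0 < q x)
    (f : V → ℝ → ℝ) (hfc : ∀ x ∈ S, Continuous (f x))
    -- condition (f.1)
    (m1 m2 φ1 φ2 ψ1 ψ2 : V → ℝ)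
    (hm1 : ∀ x ∈ S, 2 ≤ m1 x) (hm2 : ∀ x ∈ S, 2 ≤ m2 x)
    (hφ1 : ∀ x ∈ S, 0 < φ1 x) (hφ2 : ∀ x ∈ S, 0 < φ2 x)
    (hψ1 : ∀ x ∈ S, 0 < ψ1 x) (hψ2 : ∀ x ∈ S, 0 < ψ2 x)
    (hf1 : ∀ x ∈ S, ∀ t : ℝ, 0 ≤ t →
      ψ1 x + φ1 x * t ^ (m1 x - 1) ≤ f x t ∧ f x t ≤ φ2 x * t ^ (m2 x - 1) + ψ2 x)
    -- m₂⁺ = p⁻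
    (hm2p : S.sup' hS m2 = S.inf' hS p)
    -- λ₁
    (lam1 : ℝ)
    (hlam1 : lam1 =
      (S.inf' hS q / S.sup' hS p) * (2 : ℝ) ^ (-(S.inf' hS p / 2)) *
          (B.card : ℝ) ^ (S.inf' hS p / 2) *
          (Fintype.card V : ℝ) ^ (1 - S.inf' hS p) /
        ((S.sup' hS φ2 / S.inf' hS m2 + S.sup' hS ψ2 * Real.sqrt (Fintype.card V)) *
          (S.card : ℝ)))
    (lam : ℝ) (hlam : 0 < lam) (hlt : lam < lam1) :
    ∃ u : V → ℝ, (∀ x ∈ B, u x = 0) ∧ (∀ x ∈ S, 0 < u x) ∧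
      ∀ x ∈ S,
        -(∑ y, |u y - u x| ^ (p x - 2) * (u y - u x) * ω x y)
          + q x * |u x| ^ (p x - 2) * u x = lam * f x (u x) := by
  have hQ : 0 < S.inf' hS q := (Finset.lt_inf'_iff hS).2 hq
  have hP' : 2 ≤ S.inf' hS p := Finset.le_inf' hS _ fun x _ => hp x
  obtain ⟨a, ha⟩ := hS
  have hkey := threshold_mul_le (P := S.sup' ⟨a, ha⟩ p) (M := S.inf' ⟨a, ha⟩ m2)
    (Φ := S.sup' ⟨a, ha⟩ φ2) (Ψ := S.sup' ⟨a, ha⟩ ψ2) (b := B.card) (n := Fintype.card V)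
    (s := S.card) hQ hP' ((Finset.inf'_le p ha).trans (Finset.le_sup' p ha))
    (two_pos.trans_le (Finset.le_inf' _ _ hm2))
    (hm2p ▸ (Finset.inf'_le m2 ha).trans (Finset.le_sup' m2 ha))
    ((hφ2 a ha).trans_le (Finset.le_sup' φ2 ha)) ((hψ2 a ha).trans_le (Finset.le_sup' ψ2 ha))
    (Nat.cast_nonneg _) (mod_cast Finset.card_le_univ B)
    (mod_cast Fintype.card_pos_iff.2 ⟨a⟩) (mod_cast Finset.card_pos.2 ⟨a, ha⟩)
  rw [← hlam1] at hkey
  have hlamf : ∀ x ∈ S, lam * f x 1 ≤ q x := by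
    intro x hx
    have hf := (hf1 x hx 1 zero_le_one).2
    rw [Real.one_rpow, mul_one] at hf
    have hφ := Finset.le_sup' φ2 hx
    have hψ := Finset.le_sup' ψ2 hx
    have hφ0 := hφ2 x hx
    have hψ0 := hψ2 x hx
    calc lam * f x 1 ≤ lam * (S.sup' ⟨a, ha⟩ φ2 + S.sup' ⟨a, ha⟩ ψ2) := by gcongr; linarith
      _ ≤ lam1 * (S.sup' ⟨a, ha⟩ φ2 + S.sup' ⟨a, ha⟩ ψ2) :=
        mul_le_mul_of_nonneg_right hlt.le (by linarith)
      _ ≤ S.inf' ⟨a, ha⟩ q := hkey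
      _ ≤ q x := Finset.inf'_le q hx
  have hr : ∀ x, 0 ≤ p x - 2 := fun x => sub_nonneg.2 (hp x)
  let G : V → (V → ℝ) → ℝ := fun x u =>
    -(∑ y, |u y - u x| ^ (p x - 2) * (u y - u x) * ω x y)
      + q x * (|u x| ^ (p x - 2) * u x) - lam * f x (u x)
  let w : V → ℝ := fun x => if x ∈ S then 1 else 0
  have hw0 : 0 ≤ w := fun x => by by_cases hx : x ∈ S <;> simp [w, hx]
  have hw1 : ∀ x, w x ≤ 1 := fun x => by by_cases hx : x ∈ S <;> simp [w, hx]
  have hc : ∀ x ∈ S, Continuous (G x) := by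
    intro x hx
    have h := continuous_abs_rpow_mul_self (hr x)
    refine ((continuous_finsetSum _ fun y _ => ?_).neg.add ?_).sub ?_
    · exact (h.comp ((continuous_apply y).sub (continuous_apply x))).mul continuous_const
    · exact continuous_const.mul (h.comp (continuous_apply x))
    · exact continuous_const.mul ((hfc x hx).comp (continuous_apply x))
  have hG : ∀ x ∈ S, ∀ u v : V → ℝ, u ≤ v → u x = v x → G x v ≤ G x u := by
    intro x _ u v huv hxx
    simp only [G, ← hxx]
    refine sub_le_sub_right (add_le_add_left (neg_le_neg (Finset.sum_le_sum fun y _ => ?_)) _) _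
    exact mul_le_mul_of_nonneg_right
      (monotone_abs_rpow_mul_self (hr x) (sub_le_sub_right (huv y) (u x))) (hnn x y)
  have hf0 : ∀ x ∈ S, 0 < lam * f x 0 := by
    intro x hx
    have h := (hf1 x hx 0 le_rfl).1
    rw [Real.zero_rpow (by linarith [hm1 x hx]), mul_zero, add_zero] at h
    exact mul_pos hlam ((hψ1 x hx).trans_le h)
  obtain ⟨u, ⟨hu0, huw⟩, hu⟩ := exists_eq_zero_between_sub_and_supersolution S G hc hG hw0
    (fun x hx => by simpa [G] using (hf0 x hx).le) (by
      intro x hx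
      have hwx : w x = 1 := if_pos hx
      have hsum : ∑ y, |w y - 1| ^ (p x - 2) * (w y - 1) * ω x y ≤ 0 :=
        Finset.sum_nonpos fun y _ => mul_nonpos_of_nonpos_of_nonneg
          (mul_nonpos_of_nonneg_of_nonpos (by positivity) (by linarith [hw1 y])) (hnn x y)
      simp only [G, hwx, abs_one, Real.one_rpow, mul_one]
      linarith [hlamf x hx])
  refine ⟨u, fun x hx => ?_, fun x hx => lt_of_le_of_ne (hu0 x) fun h => ?_, fun x hx => ?_⟩
  · have hwx : w x = 0 := if_neg (Finset.disjoint_right.1 hdisj hx)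
    exact le_antisymm (hwx ▸ huw x) (hu0 x)
  · have h1 := hG x hx 0 u hu0 h
    have h2 : G x 0 < 0 := by simpa [G] using hf0 x hx
    exact absurd (hu x hx) (h1.trans_lt h2).ne
  · have := hu x hx
    simp only [G] at this
    linarith
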